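/- Assume (A3), (A5) and (A7), and assume V_L < V_max. Then there exists a unique open subinterval J = (J₋, J₊) with [J₋, J₊] ⊂ I such that: (i) the unique solution (f₋, f₊) of Luckock's equation on [J₋, J₊] satisfies f₋(J₋) = 0 = f₊(J₊), and (ii) λ₋(x) < λ₋(J₋) for all x ∈ (J₋, J₊] and λ₊(x) < λ₊(J₊) for all x ∈ [J₋, J₊). This subinterval is J = J^c := (λ₋⁻¹(V_L), λ₊⁻¹(V_L)). -/

import Mathlib

open MeasureTheory Set
open scoped ENNReal

noncomputable section

/-- The right limit of `f` at `x`, with the convention `f(b+) := f b` at the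
right endpoint `b`. -/
def rLim (b : ℝ) (f : ℝ → ℝ) (x : ℝ) : ℝ :=
  if x < b then Function.rightLim f x else f b

/-- `ν` is the Lebesgue-Stieltjes signed measure `df` of `f` on the interval `[a,b]`,
with the conventions `f(a−) := f a` and `f(b+) := f b`. -/
def IsLS (a b : ℝ) (f : ℝ → ℝ) (ν : MeasureTheory.SignedMeasure ℝ) : Prop :=
  (∀ s : Set ℝ, MeasurableSet s → s ∩ Set.Icc a b = ∅ → ν s = 0) ∧
  (∀ x y : ℝ, a ≤ x → x ≤ y → y ≤ b → ν (Set.Ioc x y) = rLim b f y - rLim b f x) ∧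
  ν {a} = rLim b f a - f a

/-- The integral `∫_s g dν` of `g` over `s` against the signed measure `ν`. -/
def sInt (ν : MeasureTheory.SignedMeasure ℝ) (g : ℝ → ℝ) (s : Set ℝ) : ℝ :=
  (∫ x in s, g x ∂ν.toJordanDecomposition.posPart) -
    ∫ x in s, g x ∂ν.toJordanDecomposition.negPart

/-- Assumption (A3): `lm` (demand) is continuous and nonincreasing, `lp` (supply) is
continuous and nondecreasing on `[a,b]`; both are nonnegative. -/
def A3 (a b : ℝ) (lm lp : ℝ → ℝ) : Prop :=
  ContinuousOn lm (Set.Icc a b) ∧ ContinuousOn lp (Set.Icc a b) ∧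
  AntitoneOn lm (Set.Icc a b) ∧ MonotoneOn lp (Set.Icc a b) ∧
  (∀ x ∈ Set.Icc a b, 0 ≤ lm x) ∧ (∀ x ∈ Set.Icc a b, 0 ≤ lp x)

/-- Assumption (A6): the rates of market orders are positive. -/
def A6 (a b : ℝ) (lm lp : ℝ → ℝ) : Prop := 0 < lp a ∧ 0 < lm b

/-- `(fm, fp)` is a solution of Luckock's equation on `[a,b]` for demand/supply `lm, lp`:
both are continuous of bounded variation, `fm dlp + lm dfp = 0` and `fp dlm + lp dfm = 0`
as signed measures on `[a,b]`, and `fm b = 1 = fp a`. -/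
def LuckockSol (a b : ℝ) (lm lp fm fp : ℝ → ℝ) : Prop :=
  ContinuousOn fm (Set.Icc a b) ∧ ContinuousOn fp (Set.Icc a b) ∧
  BoundedVariationOn fm (Set.Icc a b) ∧ BoundedVariationOn fp (Set.Icc a b) ∧
  fm b = 1 ∧ fp a = 1 ∧
  ∀ νlm νlp νfm νfp : MeasureTheory.SignedMeasure ℝ,
    IsLS a b lm νlm → IsLS a b lp νlp → IsLS a b fm νfm → IsLS a b fp νfp →
    ∀ s : Set ℝ, MeasurableSet s →
      sInt νlp fm s + sInt νfp lm s = 0 ∧ sInt νlm fp s + sInt νfm lp s = 0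

/-- Assumption (A5): `lm` and `lp` are positive on the open interval `(a,b)`. -/
def A5 (a b : ℝ) (lm lp : ℝ → ℝ) : Prop := ∀ x ∈ Set.Ioo a b, 0 < lm x ∧ 0 < lp x

/-- The Walrasian volume of trade `V_W`. -/
def VWal (a b : ℝ) (lm lp : ℝ → ℝ) : ℝ :=
  sSup ((fun x => min (lm x) (lp x)) '' Set.Icc a b)

/-- The maximal volume of trade `V_max`. -/
def Vmax (a b : ℝ) (lm lp : ℝ → ℝ) : ℝ := min (lm a) (lp b)

/-- The left-continuous inverse `λ₋⁻¹(V) = sup {x ∈ [a,b] : lm x ≥ V}`. -/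
def linvm (a b : ℝ) (lm : ℝ → ℝ) (V : ℝ) : ℝ := sSup {x | x ∈ Set.Icc a b ∧ V ≤ lm x}

/-- The left-continuous inverse `λ₊⁻¹(V) = inf {x ∈ [a,b] : lp x ≥ V}`. -/
def linvp (a b : ℝ) (lp : ℝ → ℝ) (V : ℝ) : ℝ := sInf {x | x ∈ Set.Icc a b ∧ V ≤ lp x}

/-- The function `Φ(V) = ∫_{V_W}^V (1/λ₊(λ₋⁻¹(W)) + 1/λ₋(λ₊⁻¹(W))) W⁻² dW`,
with values in `[0,∞]`. -/
def Phi (a b : ℝ) (lm lp : ℝ → ℝ) (V : ℝ) : ℝ≥0∞ :=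
  ∫⁻ W in Set.Ioc (VWal a b lm lp) V,
    ENNReal.ofReal (((lp (linvm a b lm W))⁻¹ + (lm (linvp a b lp W))⁻¹) * (W ^ 2)⁻¹)

/-- Luckock's volume of trade `V_L`. -/
def VLuc (a b : ℝ) (lm lp : ℝ → ℝ) : ℝ :=
  sSup {V | V ∈ Set.Icc (VWal a b lm lp) (Vmax a b lm lp) ∧
    Phi a b lm lp V ≤ ENNReal.ofReal (((VWal a b lm lp) ^ 2)⁻¹)}

/-- The two conditions characterizing the competitive window `J = (J₋, J₊)`:
(i) the unique solution of Luckock's equation on `[J₋,J₊]` vanishes at the endpoints,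
(ii) `λ₋ < λ₋(J₋)` on `(J₋,J₊]` and `λ₊ < λ₊(J₊)` on `[J₋,J₊)`. -/
def WindowCond (lm lp : ℝ → ℝ) (Jm Jp : ℝ) : Prop :=
  (∃ fm fp : ℝ → ℝ, LuckockSol Jm Jp lm lp fm fp ∧ fm Jm = 0 ∧ fp Jp = 0) ∧
  (∀ x ∈ Set.Ioc Jm Jp, lm x < lm Jm) ∧
  (∀ x ∈ Set.Ico Jm Jp, lp x < lp Jp)

/-- The interval function `φ` is `o(m)` on `[u, v]`: on short intervals `[x, y]`, the value `φ x y`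
is small compared to `m y - m x`. -/
def IsSmall (u v : ℝ) (m : ℝ → ℝ) (φ : ℝ → ℝ → ℝ) : Prop :=
  ∀ ε > 0, ∃ δ > 0, ∀ x y, u ≤ x → x ≤ y → y ≤ v → y - x < δ → |φ x y| ≤ ε * (m y - m x)

namespace IsSmall

variable {u v : ℝ} {m : ℝ → ℝ} {φ ψ : ℝ → ℝ → ℝ}

theorem congr (h : IsSmall u v m φ) (hφ : ∀ x y, u ≤ x → x ≤ y → y ≤ v → ψ x y = φ x y) :
    IsSmall u v m ψ := by
  intro ε hε
  obtain ⟨δ, hδ, H⟩ := h ε hε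
  exact ⟨δ, hδ, fun x y hx hxy hy hd ↦ by rw [hφ x y hx hxy hy]; exact H x y hx hxy hy hd⟩

theorem add (h : IsSmall u v m φ) (h' : IsSmall u v m ψ) :
    IsSmall u v m (fun x y ↦ φ x y + ψ x y) := by
  intro ε hε
  obtain ⟨δ, hδ, H⟩ := h (ε / 2) (by positivity)
  obtain ⟨δ', hδ', H'⟩ := h' (ε / 2) (by positivity)
  refine ⟨min δ δ', lt_min hδ hδ', fun x y hx hxy hy hd ↦ ?_⟩
  have h1 := H x y hx hxy hy (hd.trans_le (min_le_left _ _))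
  have h2 := H' x y hx hxy hy (hd.trans_le (min_le_right _ _))
  have h3 := abs_add_le (φ x y) (ψ x y)
  linarith

theorem mul_continuousOn (h : IsSmall u v m φ) {c : ℝ × ℝ → ℝ}
    (hc : ContinuousOn c (Icc u v ×ˢ Icc u v)) :
    IsSmall u v m (fun x y ↦ c (x, y) * φ x y) := by
  obtain ⟨C, hC⟩ := (isCompact_Icc.prod isCompact_Icc).exists_bound_of_continuousOn hc
  intro ε hε
  have hD : 0 < max C 1 := lt_max_of_lt_right one_pos
  obtain ⟨δ, hδ, H⟩ := h (ε / max C 1) (by positivity)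
  refine ⟨δ, hδ, fun x y hx hxy hy hd ↦ ?_⟩
  have h1 := H x y hx hxy hy hd
  have h2 : |c (x, y)| ≤ max C 1 :=
    (hC (x, y) ⟨⟨hx, hxy.trans hy⟩, ⟨hx.trans hxy, hy⟩⟩).trans (le_max_left _ _)
  rw [abs_mul]
  calc |c (x, y)| * |φ x y| ≤ max C 1 * (ε / max C 1 * (m y - m x)) :=
        mul_le_mul h2 h1 (abs_nonneg _) hD.le
    _ = ε * (m y - m x) := by field_simp

theorem const_mul (h : IsSmall u v m φ) (c : ℝ) : IsSmall u v m (fun x y ↦ c * φ x y) :=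
  h.mul_continuousOn (c := fun _ ↦ c) continuousOn_const

theorem mono (h : IsSmall u v m φ) {m' : ℝ → ℝ}
    (hm : ∀ x y, u ≤ x → x ≤ y → y ≤ v → m y - m x ≤ m' y - m' x) : IsSmall u v m' φ := by
  intro ε hε
  obtain ⟨δ, hδ, H⟩ := h ε hε
  exact ⟨δ, hδ, fun x y hx hxy hy hd ↦ (H x y hx hxy hy hd).trans
    (mul_le_mul_of_nonneg_left (hm x y hx hxy hy) hε.le)⟩

/-- The product of the increments of a continuous function and of a function controlled by `m`
is `o(m)`. -/
theorem sub_mul {f : ℝ → ℝ} (hf : ContinuousOn f (Icc u v))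
    (hφ : ∀ x y, u ≤ x → x ≤ y → y ≤ v → |φ x y| ≤ m y - m x) :
    IsSmall u v m (fun x y ↦ (f y - f x) * φ x y) := by
  intro ε hε
  obtain ⟨δ, hδ, H⟩ := Metric.uniformContinuousOn_iff.1
    (isCompact_Icc.uniformContinuousOn_of_continuous hf) ε hε
  refine ⟨δ, hδ, fun x y hx hxy hy hd ↦ ?_⟩
  have h1 := H y ⟨hx.trans hxy, hy⟩ x ⟨hx, hxy.trans hy⟩
    (by rwa [Real.dist_eq, abs_of_nonneg (by linarith)])
  rw [Real.dist_eq] at h1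
  rw [abs_mul]
  exact mul_le_mul h1.le (hφ x y hx hxy hy) (abs_nonneg _) hε.le

theorem of_abs_le (h : IsSmall u v m φ)
    (hψ : ∀ x y, u ≤ x → x ≤ y → y ≤ v → |ψ x y| ≤ |φ x y|) : IsSmall u v m ψ := by
  intro ε hε
  obtain ⟨δ, hδ, H⟩ := h ε hε
  exact ⟨δ, hδ, fun x y hx hxy hy hd ↦ (hψ x y hx hxy hy).trans (H x y hx hxy hy hd)⟩

/-- A function whose increments are `o(m)` is constant. -/
theorem eq_of_increment {F : ℝ → ℝ} (h : IsSmall u v m (fun x y ↦ F y - F x)) {x y : ℝ}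
    (hx : u ≤ x) (hxy : x ≤ y) (hy : y ≤ v) : F y = F x := by
  have key : ∀ ε > 0, |F y - F x| ≤ ε * (m y - m x) := by
    intro ε hε
    obtain ⟨δ, hδ, H⟩ := h ε hε
    obtain ⟨n, hn⟩ := exists_nat_gt ((y - x) / δ)
    have hn0 : (0 : ℝ) < n := lt_of_le_of_lt (div_nonneg (by linarith) hδ.le) hn
    let p : ℕ → ℝ := fun i ↦ x + i * ((y - x) / n)
    have hstep : ∀ i, p (i + 1) - p i = (y - x) / n := fun i ↦ by simp only [p]; push_cast; ring
    have hs0 : 0 ≤ (y - x) / n := div_nonneg (by linarith) hn0.le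
    have hpn : p n = y := by simp only [p]; field_simp; ring
    have hp0 : p 0 = x := by simp [p]
    have hmono : Monotone p := monotone_nat_of_le_succ fun i ↦ by linarith [hstep i]
    have hb : ∀ i ∈ Finset.range n, |F (p (i + 1)) - F (p i)| ≤ ε * (m (p (i + 1)) - m (p i)) := by
      intro i hi
      have hi' : i + 1 ≤ n := Finset.mem_range.1 hi
      have h0 := hmono (Nat.zero_le i)
      have h1 := hmono hi'
      have h2 := hstep i
      have h3 : (y - x) / n < δ := by
        rw [div_lt_iff₀ hδ] at hn
        rw [div_lt_iff₀ hn0]; linarith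
      exact H _ _ (by linarith) (by linarith) (by linarith) (by linarith)
    calc |F y - F x| = |∑ i ∈ Finset.range n, (F (p (i + 1)) - F (p i))| := by
          rw [Finset.sum_range_sub (fun i ↦ F (p i)), hpn, hp0]
      _ ≤ ∑ i ∈ Finset.range n, |F (p (i + 1)) - F (p i)| := Finset.abs_sum_le_sum_abs _ _
      _ ≤ ∑ i ∈ Finset.range n, ε * (m (p (i + 1)) - m (p i)) := Finset.sum_le_sum hb
      _ = ε * (m y - m x) := by
          rw [← Finset.mul_sum, Finset.sum_range_sub (fun i ↦ m (p i)), hpn, hp0]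
  have hM : |F y - F x| ≤ 0 := by
    by_contra! hpos
    have hm : 0 < m y - m x := by have := key 1 one_pos; linarith
    have := key (|F y - F x| / (2 * (m y - m x))) (by positivity)
    have e : |F y - F x| / (2 * (m y - m x)) * (m y - m x) = |F y - F x| / 2 := by field_simp
    linarith
  have := abs_nonpos_iff.1 hM
  linarith

end IsSmall

theorem rLim_eq {u v : ℝ} {f : ℝ → ℝ} (hf : ContinuousOn f (Icc u v)) {x : ℝ}
    (hx : x ∈ Icc u v) : rLim v f x = f x := by
  rcases hx.2.lt_or_eq with h | rfl
  · rw [rLim, if_pos h]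
    refine ContinuousWithinAt.rightLim_eq ((hf x hx).mono_of_mem_nhdsWithin ?_)
    exact Filter.mem_of_superset (Icc_mem_nhdsGE h) (Icc_subset_Icc_left hx.1)
  · simp [rLim]

namespace IsLS

variable {u v : ℝ} {f g : ℝ → ℝ} {ν : SignedMeasure ℝ}

theorem apply_Ioc (h : IsLS u v f ν) (hf : ContinuousOn f (Icc u v)) {x y : ℝ} (hx : u ≤ x)
    (hxy : x ≤ y) (hy : y ≤ v) : ν (Ioc x y) = f y - f x := by
  rw [h.2.1 x y hx hxy hy, rLim_eq hf ⟨hx.trans hxy, hy⟩, rLim_eq hf ⟨hx, hxy.trans hy⟩]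

theorem totalVariation_compl (h : IsLS u v f ν) (huv : u ≤ v) (hf : ContinuousOn f (Icc u v)) :
    ν.totalVariation (Ioc u v)ᶜ = 0 := by
  have hnull : ∀ t, MeasurableSet t → t ⊆ (Ioc u v)ᶜ → ν t = 0 := by
    intro t ht hts
    have hu : ν {u} = 0 := by rw [h.2.2, rLim_eq hf ⟨le_rfl, huv⟩, sub_self]
    have h1 : ν (t \ Icc u v) = 0 :=
      h.1 _ (ht.diff measurableSet_Icc) (by ext; simp)
    have h2 : ν (t ∩ Icc u v) = 0 := by
      have hsub : t ∩ Icc u v ⊆ {u} := by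
        rintro x ⟨hx, hx'⟩
        by_contra hne
        exact hts hx ⟨lt_of_le_of_ne hx'.1 (Ne.symm hne), hx'.2⟩
      rcases subset_singleton_iff_eq.1 hsub with h' | h' <;> rw [h'] <;> simp [hu]
    have h3 := VectorMeasure.of_union (v := ν)
      (disjoint_sdiff_inter (s := t) (t := Icc u v)) (ht.diff measurableSet_Icc)
      (ht.inter measurableSet_Icc)
    rw [sdiff_union_inter, h1, h2, add_zero] at h3
    exact h3
  obtain ⟨i, hi, hi2, hi3, hp, hn⟩ := ν.toJordanDecomposition_spec
  have hm : MeasurableSet (Ioc u v)ᶜ := measurableSet_Ioc.compl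
  have e1 := SignedMeasure.toMeasureOfZeroLE_real_apply ν hi2 hi hm
  have e2 := SignedMeasure.toMeasureOfLEZero_real_apply ν hi3 hi.compl hm
  rw [hnull _ (hi.inter hm) inter_subset_right] at e1
  rw [hnull _ (hi.compl.inter hm) inter_subset_right] at e2
  rw [← hp] at e1
  rw [← hn, neg_zero] at e2
  rw [SignedMeasure.totalVariation, Measure.add_apply,
    (measureReal_eq_zero_iff).1 e1, (measureReal_eq_zero_iff).1 e2, add_zero]

theorem posPart_le (ν : SignedMeasure ℝ) : ν.toJordanDecomposition.posPart ≤ ν.totalVariation :=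
  Measure.le_add_right le_rfl

theorem negPart_le (ν : SignedMeasure ℝ) : ν.toJordanDecomposition.negPart ≤ ν.totalVariation :=
  Measure.le_add_left le_rfl

theorem integrable (h : IsLS u v f ν) (huv : u ≤ v) (hf : ContinuousOn f (Icc u v))
    (hg : ContinuousOn g (Icc u v)) : Integrable g ν.totalVariation := by
  have h1 : IntegrableOn g (Icc u v) ν.totalVariation := hg.integrableOn_compact isCompact_Icc
  have h2 : IntegrableOn g (Ioc u v) ν.totalVariation := h1.mono_set Ioc_subset_Icc_self
  have h3 : ν.totalVariation.restrict (Ioc u v) = ν.totalVariation :=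
    Measure.restrict_eq_self_of_ae_mem (h.totalVariation_compl huv hf)
  rwa [IntegrableOn, h3] at h2

/-- Integration against a Lebesgue-Stieltjes measure defines a signed measure. -/
theorem exists_sInt (h : IsLS u v f ν) (huv : u ≤ v) (hf : ContinuousOn f (Icc u v))
    (hg : ContinuousOn g (Icc u v)) :
    ∃ ρ : SignedMeasure ℝ, ∀ s, MeasurableSet s →
      sInt ν g s = ρ s ∧ ρ s = ρ (s ∩ Ioc u v) := by
  have hi := h.integrable huv hf hg
  have hp := hi.mono_measure (posPart_le ν)
  have hn := hi.mono_measure (negPart_le ν)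
  have hs : ∀ s, MeasurableSet s → sInt ν g s =
      (ν.toJordanDecomposition.posPart.withDensityᵥ g -
        ν.toJordanDecomposition.negPart.withDensityᵥ g) s := by
    intro s hs
    rw [sub_apply, withDensityᵥ_apply hp hs, withDensityᵥ_apply hn hs, sInt]
  refine ⟨_, fun s hs' ↦ ⟨hs s hs', ?_⟩⟩
  rw [← hs s hs', ← hs _ (hs'.inter measurableSet_Ioc), sInt, sInt]
  have hc := h.totalVariation_compl huv hf
  have key : ∀ μ : Measure ℝ, μ ≤ ν.totalVariation →
      ∫ x in s, g x ∂μ = ∫ x in s ∩ Ioc u v, g x ∂μ := by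
    intro μ hμ
    refine (setIntegral_congr_set (inter_ae_eq_left_of_ae_eq_univ ?_)).symm
    exact ae_eq_univ.2 (nonpos_iff_eq_zero.1 ((hμ _).trans hc.le))
  rw [key _ (posPart_le ν), key _ (negPart_le ν)]

theorem abs_sub_le (h : IsLS u v f ν) (hf : ContinuousOn f (Icc u v)) {x y : ℝ} (hx : u ≤ x)
    (hxy : x ≤ y) (hy : y ≤ v) : |f y - f x| ≤ ν.totalVariation.real (Ioc x y) := by
  rw [← h.apply_Ioc hf hx hxy hy, ν.apply_eq_posPart_real_sub_negPart_real measurableSet_Ioc,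
    SignedMeasure.totalVariation, measureReal_add_apply, abs_le]
  have h1 := measureReal_nonneg (μ := ν.toJordanDecomposition.posPart) (s := Ioc x y)
  have h2 := measureReal_nonneg (μ := ν.toJordanDecomposition.negPart) (s := Ioc x y)
  constructor <;> linarith

theorem real_Ioc_sub (μ : Measure ℝ) [IsFiniteMeasure μ] {x y : ℝ} (hx : u ≤ x) (hxy : x ≤ y) :
    μ.real (Ioc u y) - μ.real (Ioc u x) = μ.real (Ioc x y) := by
  rw [← Ioc_union_Ioc_eq_Ioc hx hxy, measureReal_union
    (Set.disjoint_left.2 fun z hz hz' ↦ absurd hz.2 (not_le.2 hz'.1)) measurableSet_Ioc]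
  ring

theorem isSmall (h : IsLS u v f ν) (huv : u ≤ v) (hf : ContinuousOn f (Icc u v))
    (hg : ContinuousOn g (Icc u v)) :
    IsSmall u v (fun x ↦ ν.totalVariation.real (Ioc u x))
      (fun x y ↦ sInt ν g (Ioc x y) - g x * (f y - f x)) := by
  intro ε hε
  obtain ⟨δ, hδ, H⟩ := Metric.uniformContinuousOn_iff.1
    (isCompact_Icc.uniformContinuousOn_of_continuous hg) ε hε
  refine ⟨δ, hδ, fun x y hx hxy hy hd ↦ ?_⟩
  have hosc : ∀ z ∈ Ioc x y, ‖g z - g x‖ ≤ ε := by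
    intro z hz
    have := H z ⟨hx.trans hz.1.le, hz.2.trans hy⟩ x ⟨hx, hxy.trans hy⟩
      (by rw [Real.dist_eq, abs_of_nonneg (by linarith [hz.1])]; linarith [hz.2])
    exact this.le
  have hi := h.integrable huv hf hg
  have key : ∀ μ : Measure ℝ, IsFiniteMeasure μ → μ ≤ ν.totalVariation →
      |(∫ z in Ioc x y, g z ∂μ) - g x * μ.real (Ioc x y)| ≤ ε * μ.real (Ioc x y) := by
    intro μ _ hμ
    have h1 : (∫ z in Ioc x y, (g z - g x) ∂μ) =
        (∫ z in Ioc x y, g z ∂μ) - g x * μ.real (Ioc x y) := by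
      rw [integral_sub (hi.mono_measure hμ).integrableOn (integrable_const _)]
      simp [mul_comm]
    rw [← h1]
    exact norm_setIntegral_le_of_norm_le_const (measure_lt_top _ _) hosc
  have kp := key _ inferInstance (posPart_le ν)
  have kn := key _ inferInstance (negPart_le ν)
  beta_reduce
  rw [real_Ioc_sub _ hx hxy, ← h.apply_Ioc hf hx hxy hy,
    ν.apply_eq_posPart_real_sub_negPart_real measurableSet_Ioc,
    SignedMeasure.totalVariation, measureReal_add_apply, sInt]
  rw [abs_le] at kp kn ⊢
  constructor <;> linarith [kp.1, kp.2, kn.1, kn.2]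

end IsLS

theorem exists_isLS {u v : ℝ} (huv : u ≤ v) {f : ℝ → ℝ} (hf : ContinuousOn f (Icc u v))
    (hbv : BoundedVariationOn f (Icc u v)) : ∃ ν : SignedMeasure ℝ, IsLS u v f ν := by
  let F : ℝ → ℝ := fun x ↦ f (projIcc u v huv x)
  have hFc : Continuous F :=
    (continuousOn_iff_continuous_domRestrict.1 hf).comp continuous_projIcc
  have hFe : ∀ x ∈ Icc u v, F x = f x := fun x hx ↦ by simp [F, projIcc_of_mem huv hx]
  have hF : BoundedVariationOn F univ := by
    have h1 := eVariationOn.comp_le_of_monotoneOn f (s := Icc u v) (t := univ)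
      (fun x ↦ (projIcc u v huv x : ℝ)) (fun x _ y _ hxy ↦ monotone_projIcc huv hxy)
      (fun x _ ↦ (projIcc u v huv x).2)
    exact ne_top_of_le_ne_top hbv h1
  have hr : ∀ x, F.rightLim x = F x := fun x ↦ hFc.continuousWithinAt.rightLim_eq
  have hl : ∀ x, F.leftLim x = F x := fun x ↦ hFc.continuousWithinAt.leftLim_eq
  have hI : MeasurableSet (Icc u v) := measurableSet_Icc
  refine ⟨hF.vectorMeasure.restrict (Icc u v), fun s hs hs' ↦ ?_, fun x y hx hxy hy ↦ ?_, ?_⟩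
  · rw [VectorMeasure.restrict_apply _ hI hs, hs', VectorMeasure.empty]
  · rw [VectorMeasure.restrict_eq_self _ hI measurableSet_Ioc
      (fun z hz ↦ ⟨hx.trans hz.1.le, hz.2.trans hy⟩), hF.vectorMeasure_Ioc hxy, hr, hr,
      rLim_eq hf ⟨hx.trans hxy, hy⟩, rLim_eq hf ⟨hx, hxy.trans hy⟩,
      hFe _ ⟨hx.trans hxy, hy⟩, hFe _ ⟨hx, hxy.trans hy⟩]
  · rw [VectorMeasure.restrict_eq_self _ hI (measurableSet_singleton u) (by simpa using huv),
      hF.vectorMeasure_singleton, hr, hl, rLim_eq hf ⟨le_rfl, huv⟩, sub_self, sub_self]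

/-- The equation `g₁ df₁ + g₂ df₂ = 0` between Lebesgue-Stieltjes measures holds if it holds
infinitesimally. -/
theorem sInt_add_eq_zero {u v : ℝ} (huv : u ≤ v) {f₁ f₂ g₁ g₂ m : ℝ → ℝ}
    {ν₁ ν₂ : SignedMeasure ℝ} (h₁ : IsLS u v f₁ ν₁) (h₂ : IsLS u v f₂ ν₂)
    (hf₁ : ContinuousOn f₁ (Icc u v)) (hf₂ : ContinuousOn f₂ (Icc u v))
    (hg₁ : ContinuousOn g₁ (Icc u v)) (hg₂ : ContinuousOn g₂ (Icc u v))
    (hm₁ : ∀ x y, u ≤ x → x ≤ y → y ≤ v → ν₁.totalVariation.real (Ioc x y) ≤ m y - m x)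
    (hm₂ : ∀ x y, u ≤ x → x ≤ y → y ≤ v → ν₂.totalVariation.real (Ioc x y) ≤ m y - m x)
    (hs : IsSmall u v m (fun x y ↦ g₁ x * (f₁ y - f₁ x) + g₂ x * (f₂ y - f₂ x)))
    {s : Set ℝ} (hsm : MeasurableSet s) : sInt ν₁ g₁ s + sInt ν₂ g₂ s = 0 := by
  obtain ⟨ρ₁, hρ₁⟩ := h₁.exists_sInt huv hf₁ hg₁
  obtain ⟨ρ₂, hρ₂⟩ := h₂.exists_sInt huv hf₂ hg₂
  have i₁ := (h₁.isSmall huv hf₁ hg₁).mono (m' := m) fun x y hx hxy hy ↦ by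
    rw [IsLS.real_Ioc_sub _ hx hxy]; exact hm₁ x y hx hxy hy
  have i₂ := (h₂.isSmall huv hf₂ hg₂).mono (m' := m) fun x y hx hxy hy ↦ by
    rw [IsLS.real_Ioc_sub _ hx hxy]; exact hm₂ x y hx hxy hy
  have hadd : ∀ (ρ : SignedMeasure ℝ) x y, u ≤ x → x ≤ y →
      ρ (Ioc u y) - ρ (Ioc u x) = ρ (Ioc x y) := by
    intro ρ x y hx hxy
    rw [← Ioc_union_Ioc_eq_Ioc hx hxy, VectorMeasure.of_union
      (Set.disjoint_left.2 fun z hz hz' ↦ absurd hz.2 (not_le.2 hz'.1))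
      measurableSet_Ioc measurableSet_Ioc]
    ring
  have hF : IsSmall u v m (fun x y ↦ (ρ₁ + ρ₂) (Ioc u y) - (ρ₁ + ρ₂) (Ioc u x)) := by
    refine ((i₁.add i₂).add hs).congr fun x y hx hxy hy ↦ ?_
    rw [hadd _ x y hx hxy, add_apply, (hρ₁ _ measurableSet_Ioc).1,
      (hρ₂ _ measurableSet_Ioc).1]
    ring
  have hIoc : ∀ x y, u ≤ x → x ≤ y → y ≤ v → (ρ₁ + ρ₂) (Ioc x y) = 0 := by
    intro x y hx hxy hy
    rw [← hadd _ x y hx hxy, hF.eq_of_increment (F := fun x ↦ (ρ₁ + ρ₂) (Ioc u x)) hx hxy hy,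
      sub_self]
  have hinter : ∀ s, MeasurableSet s → (ρ₁ + ρ₂) s = (ρ₁ + ρ₂) (s ∩ Ioc u v) := by
    intro s hs
    rw [add_apply, add_apply, (hρ₁ s hs).2, (hρ₂ s hs).2]
  have hzero : ρ₁ + ρ₂ = 0 := by
    have hgen : (inferInstance : MeasurableSpace ℝ) =
        MeasurableSpace.generateFrom {S : Set ℝ | ∃ l w, l < w ∧ Ioc l w = S} := by
      rw [← borel_eq_generateFrom_Ioc]
      exact BorelSpace.measurable_eq
    refine VectorMeasure.ext_of_generateFrom _ ?_ hgen (isPiSystem_Ioc id id) ?_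
    · rintro _ ⟨l, w, -, rfl⟩
      rw [hinter _ measurableSet_Ioc, Ioc_inter_Ioc]
      rcases le_total (l ⊔ u) (w ⊓ v) with h | h
      · rw [hIoc _ _ le_sup_right h inf_le_right]; rfl
      · rw [Ioc_eq_empty (not_lt.2 h)]; simp
    · rw [hinter _ MeasurableSet.univ, univ_inter, hIoc u v le_rfl huv le_rfl]; rfl
  rw [(hρ₁ s hsm).1, (hρ₂ s hsm).1, ← add_apply, hzero]; rfl

section Inverse

variable {a b V : ℝ} {lm lp : ℝ → ℝ}

theorem A3.reflect (h : A3 a b lm lp) :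
    A3 (-b) (-a) (fun x ↦ lp (-x)) (fun x ↦ lm (-x)) := by
  obtain ⟨h1, h2, h3, h4, h5, h6⟩ := h
  have hmem : ∀ x ∈ Icc (-b) (-a), -x ∈ Icc a b := fun x hx ↦
    ⟨by linarith [hx.2], by linarith [hx.1]⟩
  exact ⟨h2.comp continuous_neg.continuousOn hmem, h1.comp continuous_neg.continuousOn hmem,
    fun x hx y hy hxy ↦ h4 (hmem y hy) (hmem x hx) (neg_le_neg hxy),
    fun x hx y hy hxy ↦ h3 (hmem y hy) (hmem x hx) (neg_le_neg hxy),
    fun x hx ↦ h6 _ (hmem x hx), fun x hx ↦ h5 _ (hmem x hx)⟩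

theorem A5.reflect (h : A5 a b lm lp) :
    A5 (-b) (-a) (fun x ↦ lp (-x)) (fun x ↦ lm (-x)) := fun x hx ↦
  (h (-x) ⟨by linarith [hx.2], by linarith [hx.1]⟩).symm

theorem linvp_eq_neg_linvm (a b : ℝ) (lp : ℝ → ℝ) (V : ℝ) :
    linvp a b lp V = -linvm (-b) (-a) (fun x ↦ lp (-x)) V := by
  rw [linvp, linvm, Real.sInf_def]
  congr 2
  ext x
  simp only [Set.mem_neg, mem_ofPred_eq, mem_Icc]
  constructor <;> rintro ⟨⟨h1, h2⟩, h3⟩ <;> exact ⟨⟨by linarith, by linarith⟩, h3⟩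

theorem A3.lp_pos (h : A3 a b lm lp) (h5 : A5 a b lm lp) {x : ℝ} (hx : x ∈ Ioc a b) :
    0 < lp x := by
  have hm : (a + x) / 2 ∈ Ioo a b := ⟨by linarith [hx.1], by linarith [hx.1, hx.2]⟩
  exact (h5 _ hm).2.trans_le
    (h.2.2.2.1 (Ioo_subset_Icc_self hm) (Ioc_subset_Icc_self hx) (by linarith [hx.1]))

theorem le_linvm {x : ℝ} (hx : x ∈ Icc a b) (hV : V ≤ lm x) : x ≤ linvm a b lm V :=
  le_csSup ⟨b, fun _ hz ↦ hz.1.2⟩ ⟨hx, hV⟩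

theorem A3.linvm_le (h : A3 a b lm lp) (hab : a ≤ b) (hV : V ≤ lm a) {y : ℝ} (hy : y ∈ Icc a b)
    (hyV : lm y < V) : linvm a b lm V ≤ y := by
  refine csSup_le ⟨a, ⟨le_rfl, hab⟩, hV⟩ fun x hx ↦ ?_
  by_contra! hlt
  exact absurd (h.2.2.1 hy hx.1 hlt.le) (not_le.2 (hyV.trans_le hx.2))

theorem A3.linvm_mem (h : A3 a b lm lp) (hab : a ≤ b) (hV : V ≤ lm a) :
    linvm a b lm V ∈ Icc a b ∧ V ≤ lm (linvm a b lm V) := by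
  have hc : IsCompact {x | x ∈ Icc a b ∧ V ≤ lm x} :=
    isCompact_Icc.of_isClosed_subset (isClosed_Icc.isClosed_le continuousOn_const h.1)
      fun x hx ↦ hx.1
  exact hc.sSup_mem ⟨a, ⟨le_rfl, hab⟩, hV⟩

/-- The value `W ↦ 1 / λ₊(λ₋⁻¹(W))` is positive below `V` if `λ₋⁻¹(V)` is not the left endpoint. -/
theorem A3.lp_linvm_pos (h : A3 a b lm lp) (h5 : A5 a b lm lp) (hab : a ≤ b) (hV : V ≤ lm a)
    (hl : a < linvm a b lm V) {W : ℝ} (hW : W ≤ V) : 0 < lp (linvm a b lm W) := by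
  have h1 := h.linvm_mem hab hV
  have h2 := h.linvm_mem hab (hW.trans hV)
  exact h.lp_pos h5 ⟨hl.trans_le (le_linvm h1.1 (hW.trans h1.2)), h2.1.2⟩

theorem A3.monotoneOn_inv_lp_linvm (h : A3 a b lm lp) (h5 : A5 a b lm lp) (hab : a ≤ b)
    (hV : V ≤ lm a) (hl : a < linvm a b lm V) :
    MonotoneOn (fun W ↦ (lp (linvm a b lm W))⁻¹) (Iic V) := by
  intro W hW W' hW' hWW'
  have h1 := h.linvm_mem hab (le_trans hW' hV)
  have h2 := h.linvm_mem hab (le_trans hW hV)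
  exact inv_anti₀ (h.lp_linvm_pos h5 hab hV hl hW')
    (h.2.2.2.1 h1.1 h2.1 (le_linvm h1.1 (hWW'.trans h1.2)))

end Inverse

theorem intervalIntegrable_mul_inv_sq {k : ℝ → ℝ} {α β : ℝ} (hα : 0 < α) (hβ : 0 < β)
    (hk : MonotoneOn k (uIcc α β)) :
    IntervalIntegrable (fun W ↦ k W * (W ^ 2)⁻¹) volume α β := by
  refine hk.intervalIntegrable.mul_continuousOn ?_
  refine (continuousOn_id.pow 2).inv₀ fun x hx ↦ ?_
  have : 0 < x := (lt_min hα hβ).trans_le hx.1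
  exact (pow_pos this 2).ne'

theorem integral_inv_sq {α β : ℝ} (hα : 0 < α) (hαβ : α ≤ β) :
    ∫ W in α..β, (W ^ 2)⁻¹ = α⁻¹ - β⁻¹ := by
  have hpos : ∀ x ∈ uIcc α β, 0 < x := fun x hx ↦ by
    rw [uIcc_of_le hαβ] at hx; exact hα.trans_le hx.1
  have := intervalIntegral.integral_eq_sub_of_hasDerivAt (a := α) (b := β)
    (f := fun W ↦ -W⁻¹) (f' := fun W ↦ (W ^ 2)⁻¹)
    (fun x hx ↦ by have := (hasDerivAt_inv (hpos x hx).ne').neg; rw [neg_neg] at this; exact this)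
    (ContinuousOn.intervalIntegrable
      ((continuousOn_id.pow 2).inv₀ fun x hx ↦ (pow_pos (hpos x hx) 2).ne'))
  rw [this]; ring

theorem integral_mul_inv_sq_mem {k : ℝ → ℝ} {α β p q : ℝ} (hα : 0 < α) (hαβ : α ≤ β)
    (hk : MonotoneOn k (Icc α β)) (hkb : ∀ W ∈ Ioc α β, p ≤ k W ∧ k W ≤ q) :
    p * (α⁻¹ - β⁻¹) ≤ ∫ W in α..β, k W * (W ^ 2)⁻¹ ∧
      ∫ W in α..β, k W * (W ^ 2)⁻¹ ≤ q * (α⁻¹ - β⁻¹) := by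
  have hβ := hα.trans_le hαβ
  have hi := intervalIntegrable_mul_inv_sq hα hβ (by rwa [uIcc_of_le hαβ])
  have hc : ∀ c : ℝ, IntervalIntegrable (fun W ↦ c * (W ^ 2)⁻¹) volume α β := fun c ↦
    intervalIntegrable_mul_inv_sq hα hβ monotoneOn_const
  have hsq : ∀ W : ℝ, 0 ≤ (W ^ 2)⁻¹ := fun W ↦ by positivity
  constructor
  · rw [← integral_inv_sq hα hαβ, ← intervalIntegral.integral_const_mul]
    exact intervalIntegral.integral_mono_on_of_le_Ioo hαβ (hc p) hi fun W hW ↦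
      mul_le_mul_of_nonneg_right (hkb W (Ioo_subset_Ioc_self hW)).1 (hsq W)
  · rw [← integral_inv_sq hα hαβ, ← intervalIntegral.integral_const_mul]
    exact intervalIntegral.integral_mono_on_of_le_Ioo hαβ hi (hc q) fun W hW ↦
      mul_le_mul_of_nonneg_right (hkb W (Ioo_subset_Ioc_self hW)).2 (hsq W)


/-- `[u, v]` lies in the open interval `(a, b)`, demand at `u` and supply at `v` both equal `V`, and
`u`, `v` are the extreme points with this property. -/
structure Window (a b : ℝ) (lm lp : ℝ → ℝ) (u v V : ℝ) : Prop where
  a3 : A3 a b lm lp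
  a5 : A5 a b lm lp
  left : a < u
  lt : u < v
  right : v < b
  lm_left : lm u = V
  lp_right : lp v = V
  lm_lt : ∀ x ∈ Ioc u v, lm x < V
  lp_lt : ∀ x ∈ Ico u v, lp x < V

/-- The reciprocal of the supply at the price where the demand is `W`. -/
def invSupply (a b : ℝ) (lm lp : ℝ → ℝ) (W : ℝ) : ℝ := (lp (linvm a b lm W))⁻¹

/-- The primitive `∫_{λ₋(x)}^V W⁻² / λ₊(λ₋⁻¹(W)) dW`. -/
def primSupply (a b : ℝ) (lm lp : ℝ → ℝ) (V x : ℝ) : ℝ :=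
  ∫ W in lm x..V, invSupply a b lm lp W * (W ^ 2)⁻¹

/-- The primitive `∫_{λ₊(x)}^V W⁻² / λ₋(λ₊⁻¹(W)) dW`, as the mirror image of `primSupply`. -/
def primDemand (a b : ℝ) (lm lp : ℝ → ℝ) (V x : ℝ) : ℝ :=
  primSupply (-b) (-a) (fun x ↦ lp (-x)) (fun x ↦ lm (-x)) V (-x)

/-- The reciprocal of the demand at the price where the supply is `W`. -/
def invDemand (a b : ℝ) (lm lp : ℝ → ℝ) (W : ℝ) : ℝ := (lm (linvp a b lp W))⁻¹

theorem invSupply_reflect (a b : ℝ) (lm lp : ℝ → ℝ) :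
    invSupply (-b) (-a) (fun x ↦ lp (-x)) (fun x ↦ lm (-x)) = invDemand a b lm lp := by
  ext W
  simp [invSupply, invDemand, linvp_eq_neg_linvm]

theorem primDemand_eq (a b : ℝ) (lm lp : ℝ → ℝ) (V x : ℝ) :
    primDemand a b lm lp V x = ∫ W in lp x..V, invDemand a b lm lp W * (W ^ 2)⁻¹ := by
  simp [primDemand, primSupply, invSupply_reflect]

theorem IsSmall.reflect {u v : ℝ} {m : ℝ → ℝ} {φ : ℝ → ℝ → ℝ}
    (h : IsSmall (-v) (-u) (fun x ↦ -m (-x)) φ) : IsSmall u v m (fun x y ↦ φ (-y) (-x)) := by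
  intro ε hε
  obtain ⟨δ, hδ, H⟩ := h ε hε
  refine ⟨δ, hδ, fun x y hx hxy hy hd ↦ ?_⟩
  refine (H (-y) (-x) (neg_le_neg hy) (neg_le_neg hxy) (neg_le_neg hx) (by linarith)).trans_eq ?_
  simp only [neg_neg]; ring

theorem ContinuousOn.comp_fst_Icc {f : ℝ → ℝ} {u v : ℝ} (hf : ContinuousOn f (Icc u v)) :
    ContinuousOn (fun p : ℝ × ℝ ↦ f p.1) (Icc u v ×ˢ Icc u v) :=
  hf.comp continuousOn_fst fun _ hp ↦ hp.1

theorem ContinuousOn.comp_snd_Icc {f : ℝ → ℝ} {u v : ℝ} (hf : ContinuousOn f (Icc u v)) :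
    ContinuousOn (fun p : ℝ × ℝ ↦ f p.2) (Icc u v ×ˢ Icc u v) :=
  hf.comp continuousOn_snd fun _ hp ↦ hp.2

namespace Window

variable {a b u v V : ℝ} {lm lp : ℝ → ℝ}

theorem reflect (h : Window a b lm lp u v V) :
    Window (-b) (-a) (fun x ↦ lp (-x)) (fun x ↦ lm (-x)) (-v) (-u) V where
  a3 := h.a3.reflect
  a5 := h.a5.reflect
  left := neg_lt_neg h.right
  lt := neg_lt_neg h.lt
  right := neg_lt_neg h.left
  lm_left := by simpa using h.lp_right
  lp_right := by simpa using h.lm_left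
  lm_lt x hx := h.lp_lt _ ⟨by linarith [hx.2], by linarith [hx.1]⟩
  lp_lt x hx := h.lm_lt _ ⟨by linarith [hx.2], by linarith [hx.1]⟩

theorem hab (h : Window a b lm lp u v V) : a ≤ b :=
  (h.left.trans (h.lt.trans h.right)).le

theorem Icc_subset (h : Window a b lm lp u v V) : Icc u v ⊆ Ioo a b := fun _ hx ↦
  ⟨h.left.trans_le hx.1, hx.2.trans_lt h.right⟩

theorem Icc_subset' (h : Window a b lm lp u v V) : Icc u v ⊆ Icc a b :=
  h.Icc_subset.trans Ioo_subset_Icc_self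

theorem lm_pos (h : Window a b lm lp u v V) {x : ℝ} (hx : x ∈ Icc u v) : 0 < lm x :=
  (h.a5 x (h.Icc_subset hx)).1

theorem lp_pos (h : Window a b lm lp u v V) {x : ℝ} (hx : x ∈ Icc u v) : 0 < lp x :=
  (h.a5 x (h.Icc_subset hx)).2

theorem continuousOn_lm (h : Window a b lm lp u v V) : ContinuousOn lm (Icc u v) :=
  h.a3.1.mono h.Icc_subset'

theorem continuousOn_lp (h : Window a b lm lp u v V) : ContinuousOn lp (Icc u v) :=
  h.a3.2.1.mono h.Icc_subset'

theorem antitoneOn_lm (h : Window a b lm lp u v V) : AntitoneOn lm (Icc u v) :=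
  h.a3.2.2.1.mono h.Icc_subset'

theorem monotoneOn_lp (h : Window a b lm lp u v V) : MonotoneOn lp (Icc u v) :=
  h.a3.2.2.2.1.mono h.Icc_subset'

theorem left_mem (h : Window a b lm lp u v V) : u ∈ Icc u v := left_mem_Icc.2 h.lt.le

theorem right_mem (h : Window a b lm lp u v V) : v ∈ Icc u v := right_mem_Icc.2 h.lt.le

theorem pos (h : Window a b lm lp u v V) : 0 < V := h.lm_left ▸ h.lm_pos h.left_mem

theorem lm_le (h : Window a b lm lp u v V) {x : ℝ} (hx : x ∈ Icc u v) : lm x ≤ V :=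
  h.lm_left ▸ h.antitoneOn_lm h.left_mem hx hx.1

theorem le_lm_left (h : Window a b lm lp u v V) : V ≤ lm a :=
  h.lm_left ▸ h.a3.2.2.1 (left_mem_Icc.2 h.hab) (h.Icc_subset' h.left_mem) h.left.le

theorem linvm_eq (h : Window a b lm lp u v V) : linvm a b lm V = u := by
  refine le_antisymm (le_of_forall_gt_imp_ge_of_dense fun y hy ↦ ?_)
    (le_linvm (h.Icc_subset' h.left_mem) h.lm_left.ge)
  have hm : min y v ∈ Ioc u v := ⟨lt_min hy h.lt, min_le_right _ _⟩
  exact (h.a3.linvm_le h.hab h.le_lm_left (h.Icc_subset' (Ioc_subset_Icc_self hm))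
    (h.lm_lt _ hm)).trans (min_le_left _ _)

theorem linvp_eq (h : Window a b lm lp u v V) : linvp a b lp V = v := by
  rw [linvp_eq_neg_linvm, h.reflect.linvm_eq, neg_neg]

theorem monotoneOn_invSupply (h : Window a b lm lp u v V) :
    MonotoneOn (invSupply a b lm lp) (Iic V) :=
  h.a3.monotoneOn_inv_lp_linvm h.a5 h.hab h.le_lm_left (h.linvm_eq.symm ▸ h.left)

theorem intervalIntegrable_supply (h : Window a b lm lp u v V) {α β : ℝ} (hα : 0 < α) (hβ : 0 < β)
    (hαV : α ≤ V) (hβV : β ≤ V) :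
    IntervalIntegrable (fun W ↦ invSupply a b lm lp W * (W ^ 2)⁻¹) volume α β :=
  intervalIntegrable_mul_inv_sq hα hβ (h.monotoneOn_invSupply.mono
    fun _ hx ↦ hx.2.trans (max_le hαV hβV))

theorem primSupply_sub (h : Window a b lm lp u v V) {x y : ℝ} (hx : x ∈ Icc u v)
    (hy : y ∈ Icc u v) : primSupply a b lm lp V y - primSupply a b lm lp V x =
      ∫ W in lm y..lm x, invSupply a b lm lp W * (W ^ 2)⁻¹ := by
  rw [primSupply, primSupply, ← intervalIntegral.integral_add_adjacent_intervals
    (h.intervalIntegrable_supply (h.lm_pos hy) (h.lm_pos hx) (h.lm_le hy) (h.lm_le hx))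
    (h.intervalIntegrable_supply (h.lm_pos hx) h.pos (h.lm_le hx) le_rfl), add_sub_cancel_right]

theorem primSupply_sub_mem (h : Window a b lm lp u v V) {x y : ℝ} (hx : x ∈ Icc u v)
    (hy : y ∈ Icc u v) (hxy : x ≤ y) :
    (lp y)⁻¹ * ((lm y)⁻¹ - (lm x)⁻¹) ≤ primSupply a b lm lp V y - primSupply a b lm lp V x ∧
    primSupply a b lm lp V y - primSupply a b lm lp V x ≤ (lp x)⁻¹ * ((lm y)⁻¹ - (lm x)⁻¹) := by
  rw [h.primSupply_sub hx hy]
  refine integral_mul_inv_sq_mem (h.lm_pos hy) (h.antitoneOn_lm hx hy hxy)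
    (h.monotoneOn_invSupply.mono fun W hW ↦ hW.2.trans (h.lm_le hx)) fun W hW ↦ ?_
  have hWa : W ≤ lm a := (hW.2.trans (h.lm_le hx)).trans h.le_lm_left
  have h1 : x ≤ linvm a b lm W := le_linvm (h.Icc_subset' hx) hW.2
  have h2 : linvm a b lm W ≤ y := h.a3.linvm_le h.hab hWa (h.Icc_subset' hy) hW.1
  have h3 : linvm a b lm W ∈ Icc u v := ⟨hx.1.trans h1, h2.trans hy.2⟩
  exact ⟨inv_anti₀ (h.lp_pos h3) (h.monotoneOn_lp h3 hy h2),
    inv_anti₀ (h.lp_pos hx) (h.monotoneOn_lp hx h3 h1)⟩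

theorem isSmall_mul (h : Window a b lm lp u v V) :
    IsSmall u v (fun x ↦ lp x - lm x) (fun x y ↦ (lp y - lp x) * (lm y - lm x)) := by
  refine IsSmall.sub_mul h.continuousOn_lp fun x y hx hxy hy ↦ ?_
  have hx' : x ∈ Icc u v := ⟨hx, hxy.trans hy⟩
  have hy' : y ∈ Icc u v := ⟨hx.trans hxy, hy⟩
  have := h.antitoneOn_lm hx' hy' hxy
  have := h.monotoneOn_lp hx' hy' hxy
  rw [abs_of_nonpos (by linarith)]
  linarith

theorem isSmall_supply (h : Window a b lm lp u v V) :
    IsSmall u v (fun x ↦ lp x - lm x) (fun x y ↦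
      primSupply a b lm lp V y - primSupply a b lm lp V x
        + (lm y - lm x) / (lp x * lm x * lm y)) := by
  have hc : ContinuousOn (fun p : ℝ × ℝ ↦ (lp p.1 * lp p.2 * lm p.1 * lm p.2)⁻¹)
      (Icc u v ×ˢ Icc u v) := by
    refine ContinuousOn.inv₀ (((h.continuousOn_lp.comp_fst_Icc.mul
      h.continuousOn_lp.comp_snd_Icc).mul h.continuousOn_lm.comp_fst_Icc).mul
      h.continuousOn_lm.comp_snd_Icc) fun p hp ↦ ?_
    have := h.lp_pos hp.1
    have := h.lp_pos hp.2
    have := h.lm_pos hp.1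
    have := h.lm_pos hp.2
    positivity
  refine (h.isSmall_mul.mul_continuousOn hc).of_abs_le fun x y hx hxy hy ↦ ?_
  have hx' : x ∈ Icc u v := ⟨hx, hxy.trans hy⟩
  have hy' : y ∈ Icc u v := ⟨hx.trans hxy, hy⟩
  have h2 := h.primSupply_sub_mem hx' hy' hxy
  have p1 := h.lp_pos hx'
  have p2 := h.lp_pos hy'
  have p3 := h.lm_pos hx'
  have p4 := h.lm_pos hy'
  have e1 : (lm y - lm x) / (lp x * lm x * lm y) = -((lp x)⁻¹ * ((lm y)⁻¹ - (lm x)⁻¹)) := by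
    field_simp; ring
  have e2 : (lp x * lp y * lm x * lm y)⁻¹ * ((lp y - lp x) * (lm y - lm x)) =
      (lp y)⁻¹ * ((lm y)⁻¹ - (lm x)⁻¹) - (lp x)⁻¹ * ((lm y)⁻¹ - (lm x)⁻¹) := by
    field_simp; ring
  rw [e1, e2, abs_of_nonpos (by linarith [h2.2]), abs_of_nonpos (by linarith [h2.1, h2.2])]
  linarith [h2.1]

theorem isSmall_demand (h : Window a b lm lp u v V) :
    IsSmall u v (fun x ↦ lp x - lm x) (fun x y ↦
      primDemand a b lm lp V y - primDemand a b lm lp V x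
        + (lp y - lp x) / (lm y * lp x * lp y)) := by
  have h1 := h.reflect.isSmall_supply
  have h2 : IsSmall (-v) (-u) (fun x ↦ -(lp (-x) - lm (-x))) _ :=
    h1.mono fun x y _ _ _ ↦ by linarith
  refine h2.reflect.of_abs_le fun x y hx hxy hy ↦ le_of_eq ?_
  rw [← abs_neg]
  congr 1
  simp only [neg_neg, primDemand]
  rw [mul_right_comm (lm y)]
  ring

theorem primSupply_add_primDemand (h : Window a b lm lp u v V) {x y : ℝ} (hx : x ∈ Icc u v)
    (hy : y ∈ Icc u v) :
    primSupply a b lm lp V y + primDemand a b lm lp V y - (lm y * lp y)⁻¹ =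
      primSupply a b lm lp V x + primDemand a b lm lp V x - (lm x * lp x)⁻¹ := by
  have key : IsSmall u v (fun x ↦ lp x - lm x) (fun x y ↦
      (primSupply a b lm lp V y + primDemand a b lm lp V y - (lm y * lp y)⁻¹) -
      (primSupply a b lm lp V x + primDemand a b lm lp V x - (lm x * lp x)⁻¹)) := by
    refine (h.isSmall_supply.add h.isSmall_demand).congr fun x y hx hxy hy ↦ ?_
    have hx' : x ∈ Icc u v := ⟨hx, hxy.trans hy⟩
    have hy' : y ∈ Icc u v := ⟨hx.trans hxy, hy⟩
    have p1 := h.lp_pos hx'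
    have p2 := h.lp_pos hy'
    have p3 := h.lm_pos hx'
    have p4 := h.lm_pos hy'
    have e : (lm y - lm x) / (lp x * lm x * lm y) + (lp y - lp x) / (lm y * lp x * lp y) =
      (lm x * lp x)⁻¹ - (lm y * lp y)⁻¹ := by field_simp; ring
    linear_combination -e
  rcases le_total x y with hxy | hxy
  · exact key.eq_of_increment hx.1 hxy hy.2
  · exact (key.eq_of_increment hy.1 hxy hx.2).symm

theorem primSupply_left (h : Window a b lm lp u v V) : primSupply a b lm lp V u = 0 := by
  rw [primSupply, h.lm_left, intervalIntegral.integral_same]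

theorem primDemand_right (h : Window a b lm lp u v V) : primDemand a b lm lp V v = 0 := by
  rw [primDemand_eq, h.lp_right, intervalIntegral.integral_same]

end Window


/-- The real integral `∫_{V_W}^V (1/λ₊(λ₋⁻¹(W)) + 1/λ₋(λ₊⁻¹(W))) W⁻² dW`. -/
def phiReal (a b : ℝ) (lm lp : ℝ → ℝ) (V : ℝ) : ℝ :=
  ∫ W in VWal a b lm lp..V, (invSupply a b lm lp W + invDemand a b lm lp W) * (W ^ 2)⁻¹

theorem AntitoneOn.boundedVariationOn_Icc {f : ℝ → ℝ} {u v : ℝ} (hf : AntitoneOn f (Icc u v)) :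
    BoundedVariationOn f (Icc u v) := by
  rcases lt_or_ge v u with h | h
  · rw [Icc_eq_empty (not_le.2 h)]
    simp [BoundedVariationOn]
  have h1 := hf.neg.locallyBoundedVariationOn u v (left_mem_Icc.2 h) (right_mem_Icc.2 h)
  rw [inter_self] at h1
  simpa [Function.comp_def] using (LipschitzWith.id.neg (E := ℝ)).comp_boundedVariationOn h1

theorem MonotoneOn.boundedVariationOn_Icc {f : ℝ → ℝ} {u v : ℝ} (hf : MonotoneOn f (Icc u v)) :
    BoundedVariationOn f (Icc u v) := by
  have h := (LipschitzWith.id.neg (E := ℝ)).comp_boundedVariationOn hf.neg.boundedVariationOn_Icc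
  simpa [Function.comp_def] using h

namespace Window

variable {a b u v V : ℝ} {lm lp : ℝ → ℝ}

theorem exists_crossing (h : Window a b lm lp u v V) :
    ∃ x ∈ Ioo u v, lm x = VWal a b lm lp ∧ lp x = VWal a b lm lp := by
  have hc : ContinuousOn (fun x ↦ lp x - lm x) (Icc u v) := h.continuousOn_lp.sub h.continuousOn_lm
  have h0 : (0 : ℝ) ∈ Ioo (lp u - lm u) (lp v - lm v) := by
    rw [h.lm_left, h.lp_right]
    exact ⟨by linarith [h.lp_lt u ⟨le_rfl, h.lt⟩], by linarith [h.lm_lt v ⟨h.lt, le_rfl⟩]⟩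
  obtain ⟨x, hx, hx0⟩ := intermediate_value_Ioo h.lt.le hc h0
  have hxe : lp x = lm x := by simpa [sub_eq_zero] using hx0
  have hxm := h.Icc_subset' (Ioo_subset_Icc_self hx)
  have hW : VWal a b lm lp = lm x := by
    refine IsGreatest.csSup_eq ⟨⟨x, hxm, by simp [hxe]⟩, ?_⟩
    rintro _ ⟨y, hy, rfl⟩
    rcases le_total y x with hyx | hyx
    · exact (min_le_right _ _).trans (hxe ▸ h.a3.2.2.2.1 hy hxm hyx)
    · exact (min_le_left _ _).trans (h.a3.2.2.1 hxm hy hyx)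
  exact ⟨x, hx, hW.symm, by rw [hxe, hW]⟩

theorem vWal_pos (h : Window a b lm lp u v V) : 0 < VWal a b lm lp := by
  obtain ⟨x, hx, h1, -⟩ := h.exists_crossing
  exact h1 ▸ h.lm_pos (Ioo_subset_Icc_self hx)

theorem vWal_lt (h : Window a b lm lp u v V) : VWal a b lm lp < V := by
  obtain ⟨x, hx, h1, -⟩ := h.exists_crossing
  exact h1 ▸ h.lm_lt x (Ioo_subset_Ioc_self hx)

/-- `Φ(V) = V_W⁻²` exactly if the two primitives add up to `1 / (λ₋ λ₊)` on the window. -/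
theorem phiReal_eq_iff (h : Window a b lm lp u v V) :
    phiReal a b lm lp V = ((VWal a b lm lp) ^ 2)⁻¹ ↔
      ∀ x ∈ Icc u v, primSupply a b lm lp V x + primDemand a b lm lp V x = (lm x * lp x)⁻¹ := by
  obtain ⟨z, hz, h1, h2⟩ := h.exists_crossing
  have hz' := Ioo_subset_Icc_self hz
  have hi := h.reflect.intervalIntegrable_supply h.vWal_pos h.pos h.vWal_lt.le le_rfl
  rw [invSupply_reflect] at hi
  have hP : phiReal a b lm lp V = primSupply a b lm lp V z + primDemand a b lm lp V z := by
    rw [primDemand_eq, primSupply, h1, h2, ← intervalIntegral.integral_add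
      (h.intervalIntegrable_supply h.vWal_pos h.pos h.vWal_lt.le le_rfl) hi, phiReal]
    simp only [add_mul]
  have hc : ((VWal a b lm lp) ^ 2)⁻¹ = (lm z * lp z)⁻¹ := by rw [h1, h2, sq]
  rw [hP, hc]
  refine ⟨fun H x hx ↦ ?_, fun H ↦ H z hz'⟩
  linarith [h.primSupply_add_primDemand hx hz']

theorem monotoneOn_primSupply (h : Window a b lm lp u v V) :
    MonotoneOn (primSupply a b lm lp V) (Icc u v) := by
  intro x hx y hy hxy
  have h1 := (h.primSupply_sub_mem hx hy hxy).1
  have h2 := inv_anti₀ (h.lm_pos hy) (h.antitoneOn_lm hx hy hxy)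
  have h3 := mul_nonneg (inv_pos.2 (h.lp_pos hy)).le (sub_nonneg.2 h2)
  linarith

theorem continuousOn_primSupply (h : Window a b lm lp u v V) :
    ContinuousOn (primSupply a b lm lp V) (Icc u v) := by
  have h1 := intervalIntegral.continuousOn_primitive_interval'
    (h.intervalIntegrable_supply (h.lm_pos h.right_mem) h.pos (h.lm_le h.right_mem) le_rfl)
    right_mem_uIcc
  rw [uIcc_of_le (h.lm_le h.right_mem)] at h1
  refine ((h1.comp h.continuousOn_lm fun x hx ↦
    ⟨h.antitoneOn_lm hx h.right_mem hx.2, h.lm_le hx⟩).neg).congr fun x _ ↦ ?_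
  exact intervalIntegral.integral_symm _ _

theorem neg_mem {x : ℝ} (hx : x ∈ Icc u v) : -x ∈ Icc (-v) (-u) :=
  ⟨neg_le_neg hx.2, neg_le_neg hx.1⟩

theorem antitoneOn_primDemand (h : Window a b lm lp u v V) :
    AntitoneOn (primDemand a b lm lp V) (Icc u v) := fun _ hx _ hy hxy ↦
  h.reflect.monotoneOn_primSupply (neg_mem hy) (neg_mem hx) (neg_le_neg hxy)

theorem continuousOn_primDemand (h : Window a b lm lp u v V) :
    ContinuousOn (primDemand a b lm lp V) (Icc u v) :=
  h.reflect.continuousOn_primSupply.comp continuous_neg.continuousOn fun _ hx ↦ neg_mem hx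

/-- If `Φ(V) = V_W⁻²`, then the solution of Luckock's equation on the window vanishes at the
endpoints. -/
theorem windowCond (h : Window a b lm lp u v V)
    (hV : phiReal a b lm lp V = ((VWal a b lm lp) ^ 2)⁻¹) : WindowCond lm lp u v := by
  have hS := h.phiReal_eq_iff.1 hV
  set S := primSupply a b lm lp V with hSdef
  set D := primDemand a b lm lp V with hDdef
  have hfm : ContinuousOn (fun x ↦ V * lm x * S x) (Icc u v) :=
    (continuousOn_const.mul h.continuousOn_lm).mul h.continuousOn_primSupply
  have hfp : ContinuousOn (fun x ↦ V * lp x * D x) (Icc u v) :=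
    (continuousOn_const.mul h.continuousOn_lp).mul h.continuousOn_primDemand
  have hconst : BoundedVariationOn (fun _ ↦ V) (Icc u v) :=
    (monotoneOn_const).boundedVariationOn_Icc
  have hsmall1 : IsSmall u v (fun x ↦ lp x - lm x) (fun x y ↦
      V * lm x * S x * (lp y - lp x) + lm x * (V * lp y * D y - V * lp x * D x)) := by
    have c1 : ContinuousOn (fun p : ℝ × ℝ ↦ V * lm p.1 * lp p.2) (Icc u v ×ˢ Icc u v) :=
      (continuousOn_const.mul h.continuousOn_lm.comp_fst_Icc).mul h.continuousOn_lp.comp_snd_Icc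
    have c2 : ContinuousOn (fun p : ℝ × ℝ ↦ V / (lp p.1 * lm p.2)) (Icc u v ×ˢ Icc u v) :=
      continuousOn_const.div (h.continuousOn_lp.comp_fst_Icc.mul h.continuousOn_lm.comp_snd_Icc)
        fun p hp ↦ (mul_pos (h.lp_pos hp.1) (h.lm_pos hp.2)).ne'
    refine ((h.isSmall_demand.mul_continuousOn c1).add (h.isSmall_mul.mul_continuousOn c2)).congr
      fun x y hx hxy hy ↦ ?_
    have hx' : x ∈ Icc u v := ⟨hx, hxy.trans hy⟩
    have hy' : y ∈ Icc u v := ⟨hx.trans hxy, hy⟩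
    have p1 := h.lp_pos hx'
    have p2 := h.lp_pos hy'
    have p3 := h.lm_pos hx'
    have p4 := h.lm_pos hy'
    have e : S x = (lm x * lp x)⁻¹ - D x := by linarith [hS x hx']
    rw [← hDdef, e]
    field_simp
    ring
  have hsmall2 : IsSmall u v (fun x ↦ lp x - lm x) (fun x y ↦
      V * lp x * D x * (lm y - lm x) + lp x * (V * lm y * S y - V * lm x * S x)) := by
    have c1 : ContinuousOn (fun p : ℝ × ℝ ↦ V * lp p.1 * lm p.2) (Icc u v ×ˢ Icc u v) :=
      (continuousOn_const.mul h.continuousOn_lp.comp_fst_Icc).mul h.continuousOn_lm.comp_snd_Icc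
    refine (h.isSmall_supply.mul_continuousOn c1).congr fun x y hx hxy hy ↦ ?_
    have hx' : x ∈ Icc u v := ⟨hx, hxy.trans hy⟩
    have hy' : y ∈ Icc u v := ⟨hx.trans hxy, hy⟩
    have p1 := h.lp_pos hx'
    have p3 := h.lm_pos hx'
    have p4 := h.lm_pos hy'
    have e : D x = (lm x * lp x)⁻¹ - S x := by linarith [hS x hx']
    rw [← hSdef, e]
    field_simp
    ring
  refine ⟨⟨fun x ↦ V * lm x * S x, fun x ↦ V * lp x * D x, ⟨hfm, hfp, ?_, ?_, ?_, ?_, ?_⟩, ?_, ?_⟩,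
    fun x hx ↦ h.lm_left.symm ▸ h.lm_lt x hx, fun x hx ↦ h.lp_right.symm ▸ h.lp_lt x hx⟩
  · exact (hconst.mul h.antitoneOn_lm.boundedVariationOn_Icc).mul
      h.monotoneOn_primSupply.boundedVariationOn_Icc
  · exact (hconst.mul h.monotoneOn_lp.boundedVariationOn_Icc).mul
      h.antitoneOn_primDemand.boundedVariationOn_Icc
  · have h1 := hS v h.right_mem
    have h2 := h.lm_pos h.right_mem
    have h3 := h.pos
    rw [hDdef, h.primDemand_right, h.lp_right, add_zero] at h1
    simp only [h1]
    field_simp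
  · have h1 := hS u h.left_mem
    have h2 := h.lp_pos h.left_mem
    have h3 := h.pos
    rw [hSdef, h.primSupply_left, h.lm_left, zero_add] at h1
    simp only [h1]
    field_simp
  · intro νlm νlp νfm νfp i1 i2 i3 i4 s hs
    set m : ℝ → ℝ := fun x ↦ νlm.totalVariation.real (Ioc u x) + νlp.totalVariation.real (Ioc u x)
      + νfm.totalVariation.real (Ioc u x) + νfp.totalVariation.real (Ioc u x) with hm
    have hmeq : ∀ x y, u ≤ x → x ≤ y → m y - m x = νlm.totalVariation.real (Ioc x y)
        + νlp.totalVariation.real (Ioc x y) + νfm.totalVariation.real (Ioc x y)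
        + νfp.totalVariation.real (Ioc x y) := by
      intro x y hx hxy
      simp only [hm, ← IsLS.real_Ioc_sub _ hx hxy]
      ring
    have hle : ∀ x y, u ≤ x → x ≤ y → y ≤ v → (lp y - lm y) - (lp x - lm x) ≤ m y - m x := by
      intro x y hx hxy hy
      rw [hmeq x y hx hxy]
      have h1 := i1.abs_sub_le h.continuousOn_lm hx hxy hy
      have h2 := i2.abs_sub_le h.continuousOn_lp hx hxy hy
      have h3 := neg_abs_le (lm y - lm x)
      have h4 := le_abs_self (lp y - lp x)
      have h5 := measureReal_nonneg (μ := νfm.totalVariation) (s := Ioc x y)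
      have h6 := measureReal_nonneg (μ := νfp.totalVariation) (s := Ioc x y)
      linarith
    have hTV : ∀ (ν : SignedMeasure ℝ) x y, 0 ≤ ν.totalVariation.real (Ioc x y) :=
      fun ν x y ↦ measureReal_nonneg
    refine ⟨sInt_add_eq_zero (m := m) h.lt.le i2 i4 h.continuousOn_lp hfp hfm h.continuousOn_lm
      (fun x y hx hxy _ ↦ ?_) (fun x y hx hxy _ ↦ ?_) (hsmall1.mono hle) hs,
      sInt_add_eq_zero (m := m) h.lt.le i1 i3 h.continuousOn_lm hfm hfp h.continuousOn_lp
      (fun x y hx hxy _ ↦ ?_) (fun x y hx hxy _ ↦ ?_) (hsmall2.mono hle) hs⟩ <;>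
    · rw [hmeq x y hx hxy]
      linarith [hTV νlm x y, hTV νlp x y, hTV νfm x y, hTV νfp x y]
  · simp [hSdef, h.primSupply_left]
  · simp [hDdef, h.primDemand_right]

end Window


/-- The infinitesimal form of Luckock's equation. -/
theorem LuckockSol.exists_isSmall {u v : ℝ} {lm lp fm fp : ℝ → ℝ} (huv : u ≤ v)
    (h : LuckockSol u v lm lp fm fp)
    (hlm : ContinuousOn lm (Icc u v)) (hlp : ContinuousOn lp (Icc u v))
    (hlm' : BoundedVariationOn lm (Icc u v)) (hlp' : BoundedVariationOn lp (Icc u v)) :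
    ∃ m : ℝ → ℝ, (∀ x y, u ≤ x → x ≤ y → y ≤ v → |lm y - lm x| + |lp y - lp x| ≤ m y - m x) ∧
      IsSmall u v m (fun x y ↦ fm x * (lp y - lp x) + lm x * (fp y - fp x)) ∧
      IsSmall u v m (fun x y ↦ fp x * (lm y - lm x) + lp x * (fm y - fm x)) := by
  obtain ⟨hfm, hfp, hfm', hfp', -, -, H⟩ := h
  obtain ⟨νlm, i1⟩ := exists_isLS huv hlm hlm'
  obtain ⟨νlp, i2⟩ := exists_isLS huv hlp hlp'
  obtain ⟨νfm, i3⟩ := exists_isLS huv hfm hfm'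
  obtain ⟨νfp, i4⟩ := exists_isLS huv hfp hfp'
  have H' := H νlm νlp νfm νfp i1 i2 i3 i4
  have hTV : ∀ (ν : SignedMeasure ℝ) x y, 0 ≤ ν.totalVariation.real (Ioc x y) :=
    fun ν x y ↦ measureReal_nonneg
  set m : ℝ → ℝ := fun x ↦ νlm.totalVariation.real (Ioc u x) + νlp.totalVariation.real (Ioc u x)
    + νfm.totalVariation.real (Ioc u x) + νfp.totalVariation.real (Ioc u x) with hm
  have hmeq : ∀ x y, u ≤ x → x ≤ y → m y - m x = νlm.totalVariation.real (Ioc x y)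
      + νlp.totalVariation.real (Ioc x y) + νfm.totalVariation.real (Ioc x y)
      + νfp.totalVariation.real (Ioc x y) := by
    intro x y hx hxy
    simp only [hm, ← IsLS.real_Ioc_sub _ hx hxy]
    ring
  have hmono : ∀ ν ∈ ({νlm, νlp, νfm, νfp} : Set (SignedMeasure ℝ)), ∀ x y, u ≤ x → x ≤ y → y ≤ v →
      ν.totalVariation.real (Ioc u y) - ν.totalVariation.real (Ioc u x) ≤ m y - m x := by
    intro ν hν x y hx hxy _
    rw [hmeq x y hx hxy, IsLS.real_Ioc_sub _ hx hxy]
    simp only [mem_insert_iff, mem_singleton_iff] at hν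
    rcases hν with hν | hν | hν | hν <;> rw [hν] <;>
    linarith [hTV νlm x y, hTV νlp x y, hTV νfm x y, hTV νfp x y]
  refine ⟨m, fun x y hx hxy hy ↦ ?_, ?_, ?_⟩
  · rw [hmeq x y hx hxy]
    linarith [i1.abs_sub_le hlm hx hxy hy, i2.abs_sub_le hlp hx hxy hy, hTV νfm x y, hTV νfp x y]
  · refine (((i2.isSmall huv hlp hfm).mono (hmono νlp (by simp))).add
      ((i4.isSmall huv hfp hlm).mono (hmono νfp (by simp)))).of_abs_le
      fun x y _ _ _ ↦ le_of_eq ?_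
    rw [← abs_neg]
    congr 1
    linarith [(H' (Ioc x y) measurableSet_Ioc).1]
  · refine (((i1.isSmall huv hlm hfp).mono (hmono νlm (by simp))).add
      ((i3.isSmall huv hfm hlp).mono (hmono νfm (by simp)))).of_abs_le
      fun x y _ _ _ ↦ le_of_eq ?_
    rw [← abs_neg]
    congr 1
    linarith [(H' (Ioc x y) measurableSet_Ioc).2]

/-- The quantity `f₋ λ₊ + f₊ λ₋` is constant for solutions of Luckock's equation. -/
theorem LuckockSol.add_eq {u v : ℝ} {lm lp fm fp : ℝ → ℝ}
    (h : LuckockSol u v lm lp fm fp)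
    (hlm : ContinuousOn lm (Icc u v)) (hlp : ContinuousOn lp (Icc u v))
    (hlm' : BoundedVariationOn lm (Icc u v)) (hlp' : BoundedVariationOn lp (Icc u v))
    {x : ℝ} (hx : x ∈ Icc u v) :
    fm x * lp x + fp x * lm x = fm u * lp u + fp u * lm u := by
  obtain ⟨m, hm, h1, h2⟩ := h.exists_isSmall (hx.1.trans hx.2) hlm hlp hlm' hlp'
  have s1 : IsSmall u v m (fun x y ↦ (fm y - fm x) * (lp y - lp x)) :=
    IsSmall.sub_mul h.1 fun x y hx hxy hy ↦ by
      linarith [hm x y hx hxy hy, abs_nonneg (lm y - lm x)]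
  have s2 : IsSmall u v m (fun x y ↦ (fp y - fp x) * (lm y - lm x)) :=
    IsSmall.sub_mul h.2.1 fun x y hx hxy hy ↦ by
      linarith [hm x y hx hxy hy, abs_nonneg (lp y - lp x)]
  exact (((h1.add h2).add (s1.add s2)).congr fun x y _ _ _ ↦ by ring).eq_of_increment
    (F := fun x ↦ fm x * lp x + fp x * lm x) le_rfl hx.1 hx.2

theorem WindowCond.window {a b u v : ℝ} {lm lp : ℝ → ℝ} (h : WindowCond lm lp u v)
    (hA3 : A3 a b lm lp) (hA5 : A5 a b lm lp) (hu : a < u) (huv : u < v) (hv : v < b) :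
    Window a b lm lp u v (lm u) ∧ phiReal a b lm lp (lm u) = ((VWal a b lm lp) ^ 2)⁻¹ := by
  obtain ⟨⟨fm, fp, hL, h0, h0'⟩, hm, hp⟩ := h
  have hsub : Icc u v ⊆ Icc a b := Icc_subset_Icc hu.le hv.le
  have b1 := (hA3.2.2.1.mono hsub).boundedVariationOn_Icc
  have b2 := (hA3.2.2.2.1.mono hsub).boundedVariationOn_Icc
  have c1 := hA3.1.mono hsub
  have c2 := hA3.2.1.mono hsub
  have hfmv : fm v = 1 := hL.2.2.2.2.1
  have hfpu : fp u = 1 := hL.2.2.2.2.2.1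
  have hsum : ∀ x ∈ Icc u v, fm x * lp x + fp x * lm x = lm u := fun x hx ↦ by
    rw [hL.add_eq c1 c2 b1 b2 hx, h0, hfpu]; ring
  have hV : lp v = lm u := by
    have := hsum v (right_mem_Icc.2 huv.le)
    rwa [hfmv, h0', one_mul, zero_mul, add_zero] at this
  have hw : Window a b lm lp u v (lm u) :=
    ⟨hA3, hA5, hu, huv, hv, rfl, hV, hm, fun x hx ↦ hV ▸ hp x hx⟩
  refine ⟨hw, hw.phiReal_eq_iff.2 fun x hx ↦ ?_⟩
  obtain ⟨m, hml, -, h2⟩ := hL.exists_isSmall huv.le c1 c2 b1 b2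
  have s := hw.isSmall_supply.mono (m' := m) fun x y hx hxy hy ↦ by
    linarith [hml x y hx hxy hy, neg_abs_le (lm y - lm x), le_abs_self (lp y - lp x)]
  have hc : ContinuousOn (fun p : ℝ × ℝ ↦ (lp p.1 * lm p.2)⁻¹) (Icc u v ×ˢ Icc u v) :=
    (c2.comp_fst_Icc.mul c1.comp_snd_Icc).inv₀
      fun p hp ↦ (mul_pos (hw.lp_pos hp.1) (hw.lm_pos hp.2)).ne'
  have hQ : IsSmall u v m (fun x y ↦ (fm y / lm y - lm u * primSupply a b lm lp (lm u) y) -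
      (fm x / lm x - lm u * primSupply a b lm lp (lm u) x)) := by
    refine ((h2.mul_continuousOn hc).add (s.const_mul (-lm u))).congr fun x y hx hxy hy ↦ ?_
    have hx' : x ∈ Icc u v := ⟨hx, hxy.trans hy⟩
    have hy' : y ∈ Icc u v := ⟨hx.trans hxy, hy⟩
    have p1 := hw.lp_pos hx'
    have p3 := hw.lm_pos hx'
    have p4 := hw.lm_pos hy'
    have e : lm u * ((lm y - lm x) / (lp x * lm x * lm y)) =
        (fm x * lp x + fp x * lm x) * ((lm y - lm x) / (lp x * lm x * lm y)) := by
      rw [hsum x hx']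
    have e2 : fm y / lm y - fm x / lm x = (lp x * lm y)⁻¹ *
        (fp x * (lm y - lm x) + lp x * (fm y - fm x)) -
        (fm x * lp x + fp x * lm x) * ((lm y - lm x) / (lp x * lm x * lm y)) := by
      field_simp; ring
    linear_combination e2 + e
  have hQv := hQ.eq_of_increment (F := fun x ↦ fm x / lm x - lm u * primSupply a b lm lp (lm u) x)
    le_rfl huv.le le_rfl
  simp only [h0, hw.primSupply_left, hfmv, zero_div, mul_zero, sub_zero] at hQv
  have hSv : primSupply a b lm lp (lm u) v = (lm v * lp v)⁻¹ := by
    have p1 := hw.pos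
    have p2 := hw.lm_pos hw.right_mem
    rw [hV]
    field_simp
    field_simp at hQv
    linarith
  have := hw.primSupply_add_primDemand hx hw.right_mem
  rw [hw.primDemand_right, hSv] at this
  linarith


section Luckock

variable {a b V : ℝ} {lm lp : ℝ → ℝ}

theorem A3.exists_lt_lm (h : A3 a b lm lp) {u : ℝ} (hu : u ∈ Ico a b) (hV : V < lm u) :
    ∃ x ∈ Ioo u b, V < lm x := by
  have hc : ContinuousWithinAt lm (Ioo u b) u :=
    (h.1 u (Ico_subset_Icc_self hu)).mono fun x hx ↦ ⟨hu.1.trans hx.1.le, hx.2.le⟩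
  have : (nhdsWithin u (Ioo u b)).NeBot := left_nhdsWithin_Ioo_neBot hu.2
  obtain ⟨x, hx, hx'⟩ := ((hc.eventually_const_lt hV).and self_mem_nhdsWithin).exists
  exact ⟨x, hx', hx⟩

theorem A3.lt_linvm (h : A3 a b lm lp) (hab : a < b) (hV : V < lm a) : a < linvm a b lm V := by
  obtain ⟨x, hx, hxV⟩ := h.exists_lt_lm ⟨le_rfl, hab⟩ hV
  exact hx.1.trans_le (le_linvm (Ioo_subset_Icc_self hx) hxV.le)

theorem A3.linvm_spec (h : A3 a b lm lp) (hab : a < b) (hV : V < lm a) (hVb : lm b < V) :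
    linvm a b lm V ∈ Ioo a b ∧ lm (linvm a b lm V) = V ∧
      ∀ x ∈ Ioc (linvm a b lm V) b, lm x < V := by
  have h1 := h.lt_linvm hab hV
  have h2 := h.linvm_mem hab.le hV.le
  have h3 : linvm a b lm V < b := h2.1.2.lt_of_ne fun he ↦ by
    have := h2.2
    rw [he] at this
    linarith
  refine ⟨⟨h1, h3⟩, le_antisymm ?_ h2.2, fun x hx ↦ ?_⟩
  · by_contra! hlt
    obtain ⟨x, hx, hxV⟩ := h.exists_lt_lm ⟨h2.1.1, h3⟩ hlt
    exact absurd hx.1 (not_lt.2 (le_linvm ⟨h1.le.trans hx.1.le, hx.2.le⟩ hxV.le))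
  · by_contra! hle
    exact absurd hx.1 (not_lt.2 (le_linvm ⟨h1.le.trans hx.1.le, hx.2⟩ hle))

theorem A3.linvp_lt (h : A3 a b lm lp) (hab : a < b) (hV : V < lp b) : linvp a b lp V < b := by
  have := h.reflect.lt_linvm (V := V) (neg_lt_neg hab) (by simpa using hV)
  rw [linvp_eq_neg_linvm]
  linarith

theorem A3.linvp_spec (h : A3 a b lm lp) (hab : a < b) (hV : V < lp b) (hVa : lp a < V) :
    linvp a b lp V ∈ Ioo a b ∧ lp (linvp a b lp V) = V ∧
      ∀ x ∈ Ico a (linvp a b lp V), lp x < V := by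
  obtain ⟨h1, h2, h3⟩ :=
    h.reflect.linvm_spec (V := V) (neg_lt_neg hab) (by simpa using hV) (by simpa using hVa)
  rw [linvp_eq_neg_linvm]
  refine ⟨⟨by linarith [h1.2], by linarith [h1.1]⟩, h2, fun x hx ↦ ?_⟩
  simpa using h3 (-x) ⟨by linarith [hx.2], by linarith [hx.1]⟩

theorem A3.min_le_vWal (h : A3 a b lm lp) {x : ℝ} (hx : x ∈ Icc a b) :
    min (lm x) (lp x) ≤ VWal a b lm lp := by
  refine le_csSup ⟨lm a, ?_⟩ ⟨x, hx, rfl⟩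
  rintro _ ⟨y, hy, rfl⟩
  exact (min_le_left _ _).trans (h.2.2.1 (left_mem_Icc.2 (hy.1.trans hy.2)) hy hy.1)

theorem A3.vWal_pos (h : A3 a b lm lp) (h5 : A5 a b lm lp) (hab : a < b) :
    0 < VWal a b lm lp := by
  have hm : (a + b) / 2 ∈ Ioo a b := ⟨by linarith, by linarith⟩
  exact (lt_min (h5 _ hm).1 (h5 _ hm).2).trans_le (h.min_le_vWal (Ioo_subset_Icc_self hm))

theorem A3.window (h : A3 a b lm lp) (h5 : A5 a b lm lp) (hab : a < b)
    (hV : VWal a b lm lp < V) (hV' : V < Vmax a b lm lp) :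
    Window a b lm lp (linvm a b lm V) (linvp a b lp V) V := by
  have hVa : V < lm a := hV'.trans_le (min_le_left _ _)
  have hVb : V < lp b := hV'.trans_le (min_le_right _ _)
  have hlmb : lm b < V := by
    rcases min_le_iff.1 (h.min_le_vWal (right_mem_Icc.2 hab.le)) with h1 | h1 <;> linarith
  have hlpa : lp a < V := by
    rcases min_le_iff.1 (h.min_le_vWal (left_mem_Icc.2 hab.le)) with h1 | h1 <;> linarith
  obtain ⟨h1, h2, h3⟩ := h.linvm_spec hab hVa hlmb
  obtain ⟨h4, h6, h7⟩ := h.linvp_spec hab hVb hlpa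
  have hlt : linvm a b lm V < linvp a b lp V := by
    by_contra! hle
    have h8 := h.2.2.2.1 (Ioo_subset_Icc_self h4) (Ioo_subset_Icc_self h1) hle
    rcases min_le_iff.1 (h.min_le_vWal (Ioo_subset_Icc_self h1)) with h9 | h9 <;> linarith
  exact ⟨h, h5, h1.1, hlt, h4.2, h2, h6, fun x hx ↦ h3 x ⟨hx.1, hx.2.trans h4.2.le⟩,
    fun x hx ↦ h7 x ⟨h1.1.le.trans hx.1, hx.2⟩⟩

/-- Conditions under which the integrand in `Φ` is well behaved up to `V`. -/
structure Admissible (a b : ℝ) (lm lp : ℝ → ℝ) (V : ℝ) : Prop where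
  a3 : A3 a b lm lp
  a5 : A5 a b lm lp
  lt : a < b
  le : V ≤ Vmax a b lm lp
  lt_linvm : a < linvm a b lm V
  linvp_lt : linvp a b lp V < b

theorem A3.admissible (h : A3 a b lm lp) (h5 : A5 a b lm lp) (hab : a < b)
    (hV : V < Vmax a b lm lp) : Admissible a b lm lp V :=
  ⟨h, h5, hab, hV.le, h.lt_linvm hab (hV.trans_le (min_le_left _ _)),
    h.linvp_lt hab (hV.trans_le (min_le_right _ _))⟩

theorem Window.admissible {u v : ℝ} (h : Window a b lm lp u v V) : Admissible a b lm lp V :=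
  ⟨h.a3, h.a5, h.left.trans (h.lt.trans h.right),
    le_min h.le_lm_left (by simpa using h.reflect.le_lm_left),
    h.linvm_eq.symm ▸ h.left, h.linvp_eq.symm ▸ h.right⟩

namespace Admissible

theorem monotoneOn (h : Admissible a b lm lp V) :
    MonotoneOn (fun W ↦ invSupply a b lm lp W + invDemand a b lm lp W) (Iic V) := by
  have h1 := h.a3.monotoneOn_inv_lp_linvm h.a5 h.lt.le (h.le.trans (min_le_left _ _)) h.lt_linvm
  have h2 : MonotoneOn (invSupply (-b) (-a) (fun x ↦ lp (-x)) (fun x ↦ lm (-x))) (Iic V) := by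
    refine h.a3.reflect.monotoneOn_inv_lp_linvm h.a5.reflect (neg_le_neg h.lt.le) ?_ ?_
    · simpa using h.le.trans (min_le_right _ _)
    · have := h.linvp_lt
      rw [linvp_eq_neg_linvm] at this
      linarith
  rw [invSupply_reflect] at h2
  exact h1.add h2

theorem pos (h : Admissible a b lm lp V) {W : ℝ} (hW : W ≤ V) :
    0 < invSupply a b lm lp W + invDemand a b lm lp W := by
  have h1 := h.a3.lp_linvm_pos h.a5 h.lt.le (h.le.trans (min_le_left _ _)) h.lt_linvm hW
  have h2 := h.a3.reflect.lp_linvm_pos (V := V) (W := W) h.a5.reflect (neg_le_neg h.lt.le)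
    (by simpa using h.le.trans (min_le_right _ _))
    (by have := h.linvp_lt; rw [linvp_eq_neg_linvm] at this; linarith) hW
  rw [← linvp_eq_neg_linvm] at h2
  exact add_pos (inv_pos.2 h1) (inv_pos.2 h2)

theorem intervalIntegrable (h : Admissible a b lm lp V) {α β : ℝ} (hα : 0 < α) (hβ : 0 < β)
    (hαV : α ≤ V) (hβV : β ≤ V) : IntervalIntegrable
      (fun W ↦ (invSupply a b lm lp W + invDemand a b lm lp W) * (W ^ 2)⁻¹) volume α β :=
  intervalIntegrable_mul_inv_sq hα hβ (h.monotoneOn.mono fun _ hx ↦ hx.2.trans (max_le hαV hβV))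

theorem phi_eq (h : Admissible a b lm lp V) (hV : VWal a b lm lp ≤ V) :
    Phi a b lm lp V = ENNReal.ofReal (phiReal a b lm lp V) := by
  have hW := h.a3.vWal_pos h.a5 h.lt
  rw [phiReal, intervalIntegral.integral_of_le hV, ofReal_integral_eq_lintegral_ofReal]
  · rfl
  · exact (h.intervalIntegrable hW (hW.trans_le hV) hV le_rfl).1
  · refine (ae_restrict_iff' measurableSet_Ioc).2 (Filter.Eventually.of_forall fun W hW' ↦ ?_)
    have := h.pos hW'.2
    positivity

theorem strictMonoOn (h : Admissible a b lm lp V) :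
    StrictMonoOn (phiReal a b lm lp) (Icc (VWal a b lm lp) V) := by
  intro α hα β hβ hαβ
  have hW := h.a3.vWal_pos h.a5 h.lt
  have hα' := hW.trans_le hα.1
  have hβ' := hW.trans_le hβ.1
  have h1 := intervalIntegral.integral_add_adjacent_intervals
    (h.intervalIntegrable hW hα' (hα.1.trans hα.2) hα.2)
    (h.intervalIntegrable hα' hβ' hα.2 hβ.2)
  have h2 := intervalIntegral.intervalIntegral_pos_of_pos_on
    (h.intervalIntegrable hα' hβ' hα.2 hβ.2)
    (fun W hW' ↦ mul_pos (h.pos (hW'.2.le.trans hβ.2))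
      (inv_pos.2 (pow_pos (hα'.trans hW'.1) 2))) hαβ
  simp only [phiReal]
  linarith

theorem continuousOn (h : Admissible a b lm lp V) (hV : VWal a b lm lp ≤ V) :
    ContinuousOn (phiReal a b lm lp) (Icc (VWal a b lm lp) V) := by
  have hW := h.a3.vWal_pos h.a5 h.lt
  have := intervalIntegral.continuousOn_primitive_interval'
    (h.intervalIntegrable hW (hW.trans_le hV) hV le_rfl) left_mem_uIcc
  rwa [uIcc_of_le hV] at this

end Admissible

theorem phi_mono (a b : ℝ) (lm lp : ℝ → ℝ) : Monotone (Phi a b lm lp) := fun _ _ hVW ↦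
  lintegral_mono_set (Ioc_subset_Ioc_right hVW)

theorem le_vLuc (hV : V ∈ Icc (VWal a b lm lp) (Vmax a b lm lp))
    (h : Phi a b lm lp V ≤ ENNReal.ofReal (((VWal a b lm lp) ^ 2)⁻¹)) : V ≤ VLuc a b lm lp :=
  le_csSup ⟨Vmax a b lm lp, fun _ hz ↦ hz.1.2⟩ ⟨hV, h⟩

theorem vLuc_eq (h3 : A3 a b lm lp) (h5 : A5 a b lm lp) (hab : a < b)
    (hV : V ∈ Ico (VWal a b lm lp) (Vmax a b lm lp))
    (h : phiReal a b lm lp V = ((VWal a b lm lp) ^ 2)⁻¹) : VLuc a b lm lp = V := by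
  have hphi := (h3.admissible h5 hab hV.2).phi_eq hV.1
  refine IsGreatest.csSup_eq ⟨⟨Ico_subset_Icc_self hV, (h ▸ hphi).le⟩, fun V' hV' ↦ ?_⟩
  by_contra! hlt
  have hlt' : V < min V' ((V + Vmax a b lm lp) / 2) := lt_min hlt (by linarith [hV.2])
  obtain ⟨V'', h1, h2, h6⟩ : ∃ V'', V < V'' ∧ V'' ≤ V' ∧ V'' < Vmax a b lm lp :=
    ⟨_, hlt', min_le_left _ _, (min_le_right _ _).trans_lt (by linarith [hV.2])⟩
  have had := h3.admissible h5 hab h6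
  have hmem : V'' ∈ Icc (VWal a b lm lp) V'' := ⟨hV.1.trans h1.le, le_rfl⟩
  have h7 := had.strictMonoOn ⟨hV.1, h1.le⟩ hmem h1
  have h8 := (phi_mono a b lm lp h2).trans hV'.2
  rw [had.phi_eq hmem.1, ENNReal.ofReal_le_ofReal_iff (by positivity)] at h8
  linarith

theorem phiReal_vLuc (h3 : A3 a b lm lp) (h5 : A5 a b lm lp) (hab : a < b)
    (hA7 : VWal a b lm lp < Vmax a b lm lp) (hVL : VLuc a b lm lp < Vmax a b lm lp) :
    VWal a b lm lp < VLuc a b lm lp ∧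
      phiReal a b lm lp (VLuc a b lm lp) = ((VWal a b lm lp) ^ 2)⁻¹ := by
  have hW := h3.vWal_pos h5 hab
  have h0 : phiReal a b lm lp (VWal a b lm lp) = 0 := intervalIntegral.integral_same
  have hc : 0 < ((VWal a b lm lp) ^ 2)⁻¹ := by positivity
  have hWL : VWal a b lm lp ≤ VLuc a b lm lp := le_vLuc ⟨le_rfl, hA7.le⟩ (by simp [Phi])
  obtain ⟨V₁, h1, h2⟩ := exists_between hVL
  have had := h3.admissible h5 hab h2
  have hW1 := hWL.trans h1.le
  have hR : ((VWal a b lm lp) ^ 2)⁻¹ < phiReal a b lm lp V₁ := by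
    by_contra! hle
    refine absurd (le_vLuc ⟨hW1, h2.le⟩ ?_) (not_le.2 h1)
    rw [had.phi_eq hW1]
    exact ENNReal.ofReal_le_ofReal hle
  obtain ⟨V, hV, hVe⟩ := intermediate_value_Ioo hW1 (had.continuousOn hW1) ⟨h0 ▸ hc, hR⟩
  rw [vLuc_eq h3 h5 hab ⟨hV.1.le, hV.2.trans h2⟩ hVe]
  exact ⟨hV.1, hVe⟩

end Luckock

/-- competitive window: assume (A3), (A5), (A7) and `V_L < V_max`.
Then there is a unique nonempty open subinterval `J = (J₋,J₊)` with `[J₋,J₊] ⊂ I`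
satisfying conditions (i) and (ii) above, namely
`J = J^c = (λ₋⁻¹(V_L), λ₊⁻¹(V_L))`. -/
theorem stmt15 (a b : ℝ) (hab : a < b) (lm lp : ℝ → ℝ)
    (hA3 : A3 a b lm lp) (hA5 : A5 a b lm lp)
    (hA7 : VWal a b lm lp < Vmax a b lm lp)
    (hVL : VLuc a b lm lp < Vmax a b lm lp) :
    (a < linvm a b lm (VLuc a b lm lp) ∧
      linvm a b lm (VLuc a b lm lp) < linvp a b lp (VLuc a b lm lp) ∧
      linvp a b lp (VLuc a b lm lp) < b ∧
      WindowCond lm lp (linvm a b lm (VLuc a b lm lp)) (linvp a b lp (VLuc a b lm lp))) ∧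
    ∀ Jm Jp : ℝ, a < Jm → Jm < Jp → Jp < b → WindowCond lm lp Jm Jp →
      Jm = linvm a b lm (VLuc a b lm lp) ∧ Jp = linvp a b lp (VLuc a b lm lp) := by
  obtain ⟨hW, hR⟩ := phiReal_vLuc hA3 hA5 hab hA7 hVL
  have hw := hA3.window hA5 hab hW hVL
  refine ⟨⟨hw.left, hw.lt, hw.right, hw.windowCond hR⟩, fun u v hu huv hv h ↦ ?_⟩
  obtain ⟨hw', hR'⟩ := h.window hA3 hA5 hu huv hv
  have had := hw'.admissible
  have hlt : lm u < Vmax a b lm lp := had.le.lt_of_ne fun he ↦ by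
    have := le_vLuc ⟨hw'.vWal_lt.le, had.le⟩ (by rw [had.phi_eq hw'.vWal_lt.le, hR'])
    linarith
  rw [vLuc_eq hA3 hA5 hab ⟨hw'.vWal_lt.le, hlt⟩ hR']
  exact ⟨hw'.linvm_eq.symm, hw'.linvp_eq.symm⟩
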